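/- No irreducible weighted shift that is a norm limit of complex symmetric operators is compact. Equivalently, if T e_n = α_n e_{n+1} with all α_n > 0 and T is a norm limit of complex symmetric operators, then (α_n) does not converge to 0. -/

import Mathlib

open Filter Topology ContinuousLinearMap

noncomputable section

def IsConjugation {H : Type*} [NormedAddCommGroup H] [InnerProductSpace ℂ H]
    (C : H → H) : Prop :=
  (∀ x y, C (x + y) = C x + C y) ∧
  (∀ (a : ℂ) (x : H), C (a • x) = (starRingEnd ℂ a) • C x) ∧
  (∀ x, ‖C x‖ = ‖x‖) ∧
  (∀ x, C (C x) = x)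

def IsCSO {H : Type*} [NormedAddCommGroup H] [InnerProductSpace ℂ H]
    [CompleteSpace H] (T : H →L[ℂ] H) : Prop :=
  ∃ C : H → H, IsConjugation C ∧ ∀ x, T x = C (adjoint T (C x))

abbrev L2 : Type := lp (fun _ : ℕ => ℂ) 2

def e (n : ℕ) : L2 := lp.single 2 n 1

/-- If `S` is complex symmetric and close to `T`, then a conjugation moves every `x` to a vector of
the same norm on which the roles of `T` and its adjoint are approximately exchanged. -/
lemma IsCSO.exists_norm_eq_and_swap {H : Type*} [NormedAddCommGroup H] [InnerProductSpace ℂ H]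
    [CompleteSpace H] {S : H →L[ℂ] H} (hS : IsCSO S) (T : H →L[ℂ] H) (x : H) :
    ∃ y : H, ‖y‖ = ‖x‖ ∧ ‖T x‖ ≤ ‖adjoint T y‖ + 2 * ‖S - T‖ * ‖x‖ ∧
      ‖T y‖ ≤ ‖adjoint T x‖ + 2 * ‖S - T‖ * ‖x‖ := by
  obtain ⟨C, ⟨-, -, hnorm, hinv⟩, hC⟩ := hS
  have hy : ‖C x‖ = ‖x‖ := hnorm x
  have hST : ∀ z, ‖S z - T z‖ ≤ ‖S - T‖ * ‖z‖ := fun z => (S - T).le_opNorm z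
  have hadj : ∀ z, ‖adjoint S z - adjoint T z‖ ≤ ‖S - T‖ * ‖z‖ := fun z => by
    have h := (adjoint (S - T)).le_opNorm z
    rwa [LinearIsometryEquiv.norm_map, map_sub] at h
  have h₁ : ‖S x‖ = ‖adjoint S (C x)‖ := by rw [hC x, hnorm]
  have h₂ : ‖S (C x)‖ = ‖adjoint S x‖ := by rw [hC (C x), hnorm, hinv]
  have h₃ := hST x
  have h₄ := hST (C x)
  have h₅ := hadj x
  have h₆ := hadj (C x)
  rw [hy] at h₄ h₆
  have h₇ := norm_sub_norm_le (T x) (S x)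
  have h₈ := norm_sub_norm_le (T (C x)) (S (C x))
  have h₉ := norm_sub_norm_le (adjoint S x) (adjoint T x)
  have h₁₀ := norm_sub_norm_le (adjoint S (C x)) (adjoint T (C x))
  rw [norm_sub_rev] at h₇ h₈
  exact ⟨C x, hy, by linarith, by linarith⟩

lemma inner_e (n : ℕ) (f : L2) : inner ℂ (e n) f = f n := by
  simp [e, lp.inner_single_left]

lemma norm_e (n : ℕ) : ‖e n‖ = 1 := by
  simp [e, lp.norm_single]

lemma e_apply (n m : ℕ) : e n m = if m = n then 1 else 0 := by
  simp [e, lp.single_apply, Pi.single_apply]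

lemma hasSum_norm_sq (f : L2) : HasSum (fun n => ‖f n‖ ^ 2) (‖f‖ ^ 2) := by
  simpa using lp.hasSum_norm (p := 2) (by norm_num) f

section Shift

variable {α : ℕ → ℝ} {T : L2 →L[ℂ] L2}

lemma adjoint_shift_apply (hT : ∀ n, T (e n) = (α n : ℂ) • e (n + 1)) (f : L2) (n : ℕ) :
    adjoint T f n = α n * f (n + 1) := by
  rw [← inner_e, adjoint_inner_right, hT, inner_smul_left, inner_e, Complex.conj_ofReal]

lemma adjoint_shift_e_zero (hT : ∀ n, T (e n) = (α n : ℂ) • e (n + 1)) :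
    adjoint T (e 0) = 0 := by
  ext n
  simp [adjoint_shift_apply hT, e_apply]

lemma adjoint_shift_e_succ (hT : ∀ n, T (e n) = (α n : ℂ) • e (n + 1)) (n : ℕ) :
    adjoint T (e (n + 1)) = (α n : ℂ) • e n := by
  ext m
  rw [adjoint_shift_apply hT, lp.coeFn_smul, Pi.smul_apply, e_apply, e_apply]
  by_cases h : m = n <;> simp [h]

lemma shift_apply_succ (hT : ∀ n, T (e n) = (α n : ℂ) • e (n + 1)) (f : L2) (n : ℕ) :
    T f (n + 1) = α n * f n := by
  rw [← inner_e, ← adjoint_inner_left, adjoint_shift_e_succ hT, inner_smul_left, inner_e,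
    Complex.conj_ofReal]

/-- A weighted shift whose weights satisfy `α n ^ 2 ≤ c + K * α (n + 1) ^ 2` satisfies
`T T* ≤ c + K T* T`. -/
lemma norm_adjoint_shift_sq_le (hT : ∀ n, T (e n) = (α n : ℂ) • e (n + 1)) {c K : ℝ}
    (hc : 0 ≤ c) (hK : 0 ≤ K) (h : ∀ n, α n ^ 2 ≤ c + K * α (n + 1) ^ 2) (f : L2) :
    ‖adjoint T f‖ ^ 2 ≤ c * ‖f‖ ^ 2 + K * ‖T f‖ ^ 2 := by
  have hf := hasSum_norm_sq f
  have hTf := hasSum_norm_sq (T f)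
  have hs₁ : Summable fun n => ‖f (n + 1)‖ ^ 2 := (summable_nat_add_iff 1).2 hf.summable
  have hs₂ : Summable fun n => ‖T f (n + 2)‖ ^ 2 := (summable_nat_add_iff 2).2 hTf.summable
  have h₁ : ∑' n, ‖f (n + 1)‖ ^ 2 ≤ ‖f‖ ^ 2 := by
    rw [← hf.tsum_eq, ← hf.summable.sum_add_tsum_nat_add 1]
    exact le_add_of_nonneg_left (by positivity)
  have h₂ : ∑' n, ‖T f (n + 2)‖ ^ 2 ≤ ‖T f‖ ^ 2 := by
    rw [← hTf.tsum_eq, ← hTf.summable.sum_add_tsum_nat_add 2]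
    exact le_add_of_nonneg_left (by positivity)
  calc ‖adjoint T f‖ ^ 2
      ≤ c * ∑' n, ‖f (n + 1)‖ ^ 2 + K * ∑' n, ‖T f (n + 2)‖ ^ 2 := by
        refine hasSum_le (fun n => ?_) (hasSum_norm_sq (adjoint T f))
          ((hs₁.hasSum.mul_left c).add (hs₂.hasSum.mul_left K))
        rw [adjoint_shift_apply hT, shift_apply_succ hT]
        simp only [norm_mul, Complex.norm_real, mul_pow, Real.norm_eq_abs, sq_abs]
        nlinarith [mul_le_mul_of_nonneg_right (h n) (sq_nonneg ‖f (n + 1)‖)]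
    _ ≤ c * ‖f‖ ^ 2 + K * ‖T f‖ ^ 2 := by gcongr

end Shift

lemma exists_sq_le_add_mul_sq_succ {α : ℕ → ℝ} (hα : ∀ n, 0 < α n)
    (h0 : Tendsto α atTop (𝓝 0)) {c : ℝ} (hc : 0 < c) :
    ∃ K : ℝ, 0 ≤ K ∧ ∀ n, α n ^ 2 ≤ c + K * α (n + 1) ^ 2 := by
  have h0' : Tendsto (fun n => α n ^ 2) atTop (𝓝 0) := by simpa using h0.pow 2
  obtain ⟨N, hN⟩ := eventually_atTop.1 (h0'.eventually_lt_const hc)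
  have hK : 0 ≤ ∑ i ∈ Finset.range N, α i ^ 2 / α (i + 1) ^ 2 :=
    Finset.sum_nonneg fun i _ => by positivity
  refine ⟨_, hK, fun n => ?_⟩
  rcases lt_or_ge n N with hn | hn
  · have hpos : 0 < α (n + 1) ^ 2 := pow_pos (hα _) 2
    have hle := Finset.single_le_sum (f := fun i => α i ^ 2 / α (i + 1) ^ 2)
      (fun i _ => by positivity) (Finset.mem_range.2 hn)
    have := (div_le_iff₀ hpos).1 hle
    linarith
  · have := hN n hn
    have := mul_nonneg hK (sq_nonneg (α (n + 1)))
    linarith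

/-- No irreducible weighted shift in the norm closure of the complex symmetric
operators is compact: the weights do not converge to `0`. -/
theorem irreducible_shift_in_closure_not_compact (α : ℕ → ℝ)
    (hα : ∀ n, 0 < α n)
    (T : L2 →L[ℂ] L2) (hT : ∀ n, T (e n) = (α n : ℂ) • e (n + 1))
    (hlim : ∃ Tseq : ℕ → (L2 →L[ℂ] L2), (∀ n, IsCSO (Tseq n)) ∧
      Tendsto Tseq atTop (𝓝 T)) :
    ¬ Tendsto α atTop (𝓝 0) := by
  intro h0
  obtain ⟨S, hS, hST⟩ := hlim
  have hpos := hα 0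
  obtain ⟨K, hK, hKα⟩ := exists_sq_le_add_mul_sq_succ hα h0 (c := α 0 ^ 2 / 4) (by positivity)
  have hε : Tendsto (fun k => ‖S k - T‖) atTop (𝓝 0) := tendsto_iff_norm_sub_tendsto_zero.1 hST
  have hbound : ∀ k, α 0 ≤
      √(α 0 ^ 2 / 4 + K * (2 * ‖S k - T‖) ^ 2) + 2 * ‖S k - T‖ := fun k => by
    obtain ⟨f, hf, h₁, h₂⟩ := (hS k).exists_norm_eq_and_swap T (e 0)
    have hTe : ‖T (e 0)‖ = α 0 := by
      rw [hT, norm_smul, norm_e, Complex.norm_real, Real.norm_of_nonneg hpos.le, mul_one]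
    rw [hTe, norm_e, mul_one] at h₁
    rw [adjoint_shift_e_zero hT, norm_zero, zero_add, norm_e, mul_one] at h₂
    have h₃ := norm_adjoint_shift_sq_le hT (by positivity) hK hKα f
    rw [hf, norm_e, one_pow, mul_one] at h₃
    refine h₁.trans (add_le_add_left (Real.le_sqrt_of_sq_le (h₃.trans ?_)) _)
    gcongr
  have hlim : Tendsto (fun k => √(α 0 ^ 2 / 4 + K * (2 * ‖S k - T‖) ^ 2) + 2 * ‖S k - T‖)
      atTop (𝓝 (√(α 0 ^ 2 / 4 + K * (2 * 0) ^ 2) + 2 * 0)) :=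
    ((((hε.const_mul 2).pow 2).const_mul K).const_add _).sqrt.add (hε.const_mul 2)
  have hle := ge_of_tendsto' hlim hbound
  have hsqrt : √(α 0 ^ 2 / 4 + K * (2 * 0) ^ 2) + 2 * 0 = α 0 / 2 := by
    rw [show α 0 ^ 2 / 4 + K * (2 * 0) ^ 2 = (α 0 / 2) ^ 2 by ring,
      Real.sqrt_sq (by positivity)]
    ring
  linarith
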